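/- The set of pairs ((t,v),(t',v')) ∈ (ℝ × 𝕋)² with t ≠ 0 ≠ t' such that the subgroup E = { m(t,v) + n(t',v') : m,n ∈ ℤ } is dense in ℝ × 𝕋 is a countable intersection of open dense subsets of (ℝ × 𝕋)² (hence residual). -/

import Mathlib

open Real

theorem aux_dense (U : Set (ℝ × AddCircle (2 * π))) (hU : U.Nonempty) :
    Dense {p : (ℝ × AddCircle (2 * π)) × (ℝ × AddCircle (2 * π)) |
      p.2.1 ≠ 0 → ∃ m n : ℤ, m • p.1 + n • p.2 ∈ U} := by
  obtain ⟨⟨a, b⟩, hab⟩ := hU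
  rintro ⟨⟨t, v⟩, ⟨t', v'⟩⟩
  by_cases h0 : t' = 0
  · exact subset_closure (fun h => absurd h0 h)
  have : Fact (0 < 2 * π) := ⟨by positivity⟩
  let N : ℕ → ℤ := fun k => -⌊((k : ℝ) + 1) * t / t'⌋
  let x : ℕ → ℝ := fun k => a - (k + 1) * t - N k * t'
  have hr : ∀ k : ℕ, ∃ r : ℝ, |r| ≤ 2 * π ∧
      (r : AddCircle (2 * π)) = b - ((k : ℤ) + 1) • v - N k • v' := by
    intro k
    obtain ⟨r, hr, h⟩ := (AddCircle.coe_image_Ico_eq (2 * π) 0).symm ▸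
      Set.mem_univ (b - ((k : ℤ) + 1) • v - N k • v')
    refine ⟨r, ?_, h⟩
    rw [abs_of_nonneg hr.1]
    linarith [hr.2]
  choose r hr1 hr2 using hr
  have hx : ∀ k, |x k| ≤ |a| + |t'| := by
    intro k
    have e : x k = a - Int.fract (((k : ℝ) + 1) * t / t') * t' := by
      simp only [x, N, Int.fract]
      push_cast
      field_simp
      ring
    rw [e]
    refine (abs_sub _ _).trans ?_
    rw [abs_mul, Int.abs_fract]
    have := (Int.fract_lt_one (((k : ℝ) + 1) * t / t')).le
    have := mul_le_mul_of_nonneg_right this (abs_nonneg t')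
    linarith
  have key : ∀ (f : ℕ → ℝ) (C : ℝ), (∀ k, |f k| ≤ C) →
      Filter.Tendsto (fun k : ℕ => f k / ((k : ℝ) + 1)) Filter.atTop (nhds 0) := by
    intro f C hf
    have h1 : Filter.Tendsto (fun k : ℕ => C * (1 / ((k : ℝ) + 1))) Filter.atTop (nhds 0) := by
      simpa using (tendsto_one_div_add_atTop_nhds_zero_nat (𝕜 := ℝ)).const_mul C
    refine squeeze_zero_norm (fun k => ?_) h1
    have hk : (0 : ℝ) < (k : ℝ) + 1 := by positivity
    rw [Real.norm_eq_abs, abs_div, abs_of_pos hk, div_eq_mul_one_div]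
    exact mul_le_mul_of_nonneg_right (hf k) (by positivity)
  have l1 : Filter.Tendsto (fun k : ℕ => t + x k / ((k : ℝ) + 1)) Filter.atTop (nhds t) := by
    simpa using (key x _ hx).const_add t
  have l2 : Filter.Tendsto (fun k : ℕ => v + ((r k / ((k : ℝ) + 1) : ℝ) : AddCircle (2 * π)))
      Filter.atTop (nhds v) := by
    have := ((AddCircle.continuous_mk' (2 * π)).tendsto 0).comp (key r _ hr1)
    simpa using this.const_add v
  refine mem_closure_of_tendsto ((l1.prodMk_nhds l2).prodMk_nhds
    (tendsto_const_nhds (x := (t', v')))) (Filter.Eventually.of_forall fun k _ => ?_)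
  refine ⟨(k : ℤ) + 1, N k, ?_⟩
  have hk : (k : ℝ) + 1 ≠ 0 := by positivity
  convert hab using 1
  refine Prod.ext ?_ ?_
  · simp only [Prod.fst_add, Prod.smul_fst, zsmul_eq_mul, x]
    push_cast
    field_simp
    ring
  · simp only [Prod.snd_add, Prod.smul_snd, smul_add]
    have : ((k : ℤ) + 1) • ((r k / ((k : ℝ) + 1) : ℝ) : AddCircle (2 * π)) = (r k : ℝ) := by
      rw [← AddCircle.coe_zsmul, zsmul_eq_mul]
      push_cast
      rw [mul_div_cancel₀ _ hk]
    rw [this, hr2]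
    abel

/-- The set of pairs of generators in ℝ × (ℝ/2πℤ) (with nonzero first coordinates)
generating a dense subgroup is a countable intersection of open dense sets. -/
theorem stmt_4 :
    ∃ S : ℕ → Set ((ℝ × AddCircle (2 * π)) × (ℝ × AddCircle (2 * π))),
      (∀ n, IsOpen (S n) ∧ Dense (S n)) ∧
      {p : (ℝ × AddCircle (2 * π)) × (ℝ × AddCircle (2 * π)) |
          p.1.1 ≠ 0 ∧ p.2.1 ≠ 0 ∧
          Dense {q : ℝ × AddCircle (2 * π) | ∃ m n : ℤ, q = m • p.1 + n • p.2}}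
        = ⋂ n, S n := by
  have : Fact (0 < 2 * π) := ⟨by positivity⟩
  obtain ⟨B, hBc, hB0, hB⟩ := TopologicalSpace.exists_countable_basis (ℝ × AddCircle (2 * π))
  have hBne : B.Nonempty := by
    obtain ⟨s, hs, -⟩ := hB.exists_subset_of_mem_open (Set.mem_univ (0 : ℝ × AddCircle (2 * π)))
      isOpen_univ
    exact ⟨s, hs⟩
  obtain ⟨U, rfl⟩ := hBc.exists_eq_range hBne
  have hUne : ∀ k, (U k).Nonempty := fun k =>
    Set.nonempty_iff_ne_empty.2 fun h => hB0 ⟨k, h⟩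
  have o1 : IsOpen {p : (ℝ × AddCircle (2 * π)) × (ℝ × AddCircle (2 * π)) | p.1.1 ≠ 0} :=
    isOpen_ne_fun (by fun_prop) (by fun_prop)
  have o2 : IsOpen {p : (ℝ × AddCircle (2 * π)) × (ℝ × AddCircle (2 * π)) | p.2.1 ≠ 0} :=
    isOpen_ne_fun (by fun_prop) (by fun_prop)
  have d1 : Dense {p : (ℝ × AddCircle (2 * π)) × (ℝ × AddCircle (2 * π)) | p.1.1 ≠ 0} :=
    (dense_compl_singleton (0 : ℝ)).preimage (isOpenMap_fst.comp isOpenMap_fst)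
  have d2 : Dense {p : (ℝ × AddCircle (2 * π)) × (ℝ × AddCircle (2 * π)) | p.2.1 ≠ 0} :=
    (dense_compl_singleton (0 : ℝ)).preimage (isOpenMap_fst.comp isOpenMap_snd)
  refine ⟨fun k => {p | p.1.1 ≠ 0 ∧ p.2.1 ≠ 0 ∧ ∃ m n : ℤ, m • p.1 + n • p.2 ∈ U k},
    fun k => ⟨?_, ?_⟩, ?_⟩
  · have hk : IsOpen (U k) := hB.isOpen ⟨k, rfl⟩
    have o3 : IsOpen {p : (ℝ × AddCircle (2 * π)) × (ℝ × AddCircle (2 * π)) |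
        ∃ m n : ℤ, m • p.1 + n • p.2 ∈ U k} := by
      simp only [Set.ofPred_exists]
      refine isOpen_iUnion fun m => isOpen_iUnion fun n => hk.preimage ?_
      exact (continuous_fst.zsmul m).add (continuous_snd.zsmul n)
    exact o1.inter (o2.inter o3)
  · refine ((d1.inter_of_isOpen_left d2 o1).inter_of_isOpen_left (aux_dense (U k) (hUne k))
      (o1.inter o2)).mono ?_
    rintro p ⟨⟨h1, h2⟩, h3⟩
    exact ⟨h1, h2, h3 h2⟩
  · ext p
    simp only [Set.mem_ofPred_eq, Set.mem_iInter]
    constructor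
    · rintro ⟨h1, h2, h3⟩ k
      obtain ⟨q, hq, m, n, rfl⟩ := hB.dense_iff.1 h3 (U k) ⟨k, rfl⟩ (hUne k)
      exact ⟨h1, h2, m, n, hq⟩
    · intro h
      refine ⟨(h 0).1, (h 0).2.1, hB.dense_iff.2 ?_⟩
      rintro _ ⟨k, rfl⟩ -
      obtain ⟨-, -, m, n, hq⟩ := h k
      exact ⟨_, hq, m, n, rfl⟩
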